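/- Let G be an inverse semigroup, M a unital C*-algebra with admissible G-action β, B ⊆ M a β-invariant closed two-sided ideal, v a unitary β-cocycle, and p ∈ M a self-adjoint element such that v_g β_g(p) v_g* − β_{g g⁻¹}(p) ∈ B for all g ∈ G. Then for all g ∈ G and all b ∈ M: v_g β_g( (2p − 1) · v_{g⁻¹} β_{g⁻¹}(b) ) − (2p − 1) β_{g g⁻¹}(b) ∈ B. (This is the computation showing that the operator S_p of the Kasparov cycle associated with a KK¹-cocycle is invariant modulo compacts under the perturbed action g ↦ v_g β_g.) -/

import Mathlib

/-- If `v` is a unitary `β`-cocycle and `p` is self-adjoint with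
`v_g β_g(p) v_g* − β_{gg⁻¹}(p) ∈ B` for all `g`, then for all `g` and `b`:
`v_g β_g((2p − 1) · v_{g⁻¹} β_{g⁻¹}(b)) − (2p − 1) β_{gg⁻¹}(b) ∈ B`. -/
theorem stmt8 {G M : Type*} [Semigroup G] [CStarAlgebra M]
    (inv : G → G)
    (hinv1 : ∀ g, g * inv g * g = g)
    (hinv2 : ∀ g, inv g * g * inv g = inv g)
    (hinv_unique : ∀ g i, g * i * g = g → i * g * i = i → i = inv g)
    (β : G → M →⋆ₙₐ[ℂ] M)
    (hβ : ∀ g h, β (g * h) = (β g).comp (β h))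
    (hadm : ∀ g : G, ∀ x y : M, β (g * inv g) x * y = x * β (g * inv g) y)
    (B : TwoSidedIdeal M)
    (hBclosed : IsClosed (B : Set M))
    (hBstar : ∀ x ∈ B, star x ∈ B)
    (hBinv : ∀ g : G, ∀ x ∈ B, β g x ∈ B)
    (v : G → M)
    (hv1 : ∀ g, star (v g) * v g = β (g * inv g) 1)
    (hv2 : ∀ g, v g * star (v g) = v (g * inv g))
    (hv3 : ∀ g h, v (g * h) = v g * β g (v h))
    (p : M) (hp : IsSelfAdjoint p)
    (hpv : ∀ g : G, v g * β g p * star (v g) - β (g * inv g) p ∈ B) :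
    ∀ (g : G) (b : M),
      v g * β g ((2 * p - 1) * (v (inv g) * β (inv g) b))
        - (2 * p - 1) * β (g * inv g) b ∈ B := by
  intro g b
  have hee : (g * inv g) * (g * inv g) = g * inv g := by
    rw [← mul_assoc, hinv1]
  have hie : g * inv g = inv (g * inv g) :=
    hinv_unique _ _ (by rw [hee, hee]) (by rw [hee, hee])
  have heg : g * inv g * g = g := hinv1 g
  have hcomp : β g (β (inv g) b) = β (g * inv g) b := by rw [hβ]; rfl
  have hvv : v (g * inv g) = v g * β g (v (inv g)) := hv3 _ _
  have hg1 := hv1 g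
  have hg2 := hv2 g
  have hB := hpv g
  have hegx : ∀ x, β (g * inv g) (β g x) = β g x := by
    intro x
    conv_rhs => rw [← heg, hβ]
    rfl
  have hA := hadm g
  have he1 := hv1 (g * inv g)
  have he2 := hv2 (g * inv g)
  rw [← hie, hee] at he1 he2
  generalize g * inv g = e at *
  have hL : ∀ x, β e x = β e 1 * x := fun x => by rw [hA, one_mul]
  have hR : ∀ x, β e x = x * β e 1 := fun x => by rw [← hA, mul_one]
  have hsa : star (v e) = v e := by
    conv_lhs => rw [← he2]
    rw [star_mul, star_star, he2]
  have hve : v e = β e 1 := by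
    rw [← he1]
    rw [hsa] at he2 ⊢
    exact he2.symm
  rw [hve] at hvv hg2
  set P := β e 1 with hP
  have hPP : P * P = P := by rw [hP, ← map_mul, one_mul]
  have hc : ∀ x, P * x = x * P := fun x => by rw [← hL, hR]
  have hw : β g (v (inv g)) = star (v g) * P := by
    rw [← hegx, hL]
    conv_lhs => rw [← hg1, mul_assoc, ← hvv]
  have hkey : v g * β g ((2 * p - 1) * (v (inv g) * β (inv g) b)) - (2 * p - 1) * β e b
      = 2 * ((v g * β g p * star (v g) - β e p) * (P * b)) := by
    have h1 : (2 * p - 1) * (v (inv g) * β (inv g) b)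
        = p * (v (inv g) * β (inv g) b) + p * (v (inv g) * β (inv g) b)
          - v (inv g) * β (inv g) b := by noncomm_ring
    have h2 : v g * (β g (v (inv g)) * (P * b)) = P * b := by
      rw [← mul_assoc, ← hvv, ← mul_assoc, hPP]
    have h3 : β g (v (inv g)) * (P * b) = star (v g) * (P * b) := by
      rw [hw, mul_assoc, ← mul_assoc P, hPP]
    have h4 : β e p * (P * b) = p * (P * b) := by
      rw [hR, mul_assoc, ← mul_assoc P, hPP]
    rw [h1, map_sub, map_add, map_mul, map_mul, hcomp, hL b, mul_sub, h2, h3, sub_mul (v g * β g p * star (v g)) _ (P * b), h4]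
    noncomm_ring
  rw [hkey]
  exact B.mul_mem_left _ _ (B.mul_mem_right _ _ hB)
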